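/- arXiv:1205.6847 — 4 statements merged into one kernel-verified Lean document; each statement's English description precedes it below -/
import Mathlib

section
/- For all integers k ≥ 2, s ≥ 1 and n ≥ ks, one has max{ C(ks+k−1, k), C(n,k) − C(n−s,k) } ≥ max{ C(ks−1, k), C(n−1,k) − C(n−s,k) } + C(n−1, k−1). -/
/-- The matching number of a family of finite sets: the maximum number of
pairwise disjoint nonempty members. -/
noncomputable def matchNum (𝓕 : Finset (Finset ℕ)) : ℕ :=
  sSup {m | ∃ M ⊆ 𝓕, M.card = m ∧ (∀ A ∈ M, A.Nonempty) ∧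
    (M : Set (Finset ℕ)).Pairwise fun A B => Disjoint A B}

/-- A family of subsets of `[n] = {1,…,n}` is stable if it is closed downwards
under the "shifting" partial order: whenever `F ∈ 𝓕` and `G ⊆ [n]` admits a
bijection `φ : F → G` with `φ x ≤ x` for all `x ∈ F`, then `G ∈ 𝓕`. -/
def Stable (n : ℕ) (𝓕 : Finset (Finset ℕ)) : Prop :=
  ∀ F ∈ 𝓕, ∀ G : Finset ℕ, G ⊆ Finset.Icc 1 n → G.card = F.card →
    (∃ φ : ℕ → ℕ, Set.BijOn φ (F : Set ℕ) (G : Set ℕ) ∧ ∀ x ∈ F, φ x ≤ x) → G ∈ 𝓕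

/-- A family of `k`-element subsets of `[n]` is saturated if adding any new
`k`-element subset of `[n]` increases the matching number. -/
def Saturated (n k : ℕ) (𝓕 : Finset (Finset ℕ)) : Prop :=
  ∀ E : Finset ℕ, E ⊆ Finset.Icc 1 n → E.card = k → E ∉ 𝓕 →
    matchNum 𝓕 < matchNum (insert E 𝓕)

theorem choose_add_mul_choose_le (a p j : ℕ) :
    a.choose (p + 1) + j * a.choose p ≤ (a + j).choose (p + 1) := by
  induction j with
  | zero => simp
  | succ j ih =>
    have h1 : (a + j + 1).choose (p + 1) = (a + j).choose p + (a + j).choose (p + 1) :=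
      Nat.choose_succ_succ _ _
    have h2 : a.choose p ≤ (a + j).choose p := Nat.choose_le_choose p (Nat.le_add_right a j)
    rw [← add_assoc, h1, add_mul, one_mul]
    lia

theorem succ_pow_self_le (p : ℕ) : (p + 1) ^ p ≤ (p + 1) * p ^ p := by
  rw [add_pow]
  calc ∑ i ∈ Finset.range (p + 1), p ^ i * 1 ^ (p - i) * p.choose i
      ≤ ∑ _i ∈ Finset.range (p + 1), p ^ p := by
        refine Finset.sum_le_sum fun i hi => ?_
        have hip : i ≤ p := Nat.lt_succ_iff.mp (Finset.mem_range.mp hi)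
        calc p ^ i * 1 ^ (p - i) * p.choose i
            = p ^ i * p.choose (p - i) := by rw [one_pow, mul_one, Nat.choose_symm hip]
          _ ≤ p ^ i * p ^ (p - i) := by gcongr; exact Nat.choose_le_pow p (p - i)
          _ = p ^ p := by rw [← pow_add, Nat.add_sub_cancel' hip]
    _ = (p + 1) * p ^ p := by simp

theorem descFactorial_add_mul_pow_le {a p r j : ℕ} (h : r * p + p ≤ a + 1) (hj : j ≤ p) :
    (a + r).descFactorial j * p ^ j ≤ a.descFactorial j * (p + 1) ^ j := by
  induction j with
  | zero => simp
  | succ j ih =>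
    have hfactor : (a + r - j) * p ≤ (a - j) * (p + 1) := by
      obtain ⟨c, rfl⟩ := Nat.exists_eq_add_of_le (show j ≤ a by lia)
      have h1 : j + c + r - j = c + r := by lia
      have h2 : j + c - j = c := by lia
      rw [h1, h2, add_mul, mul_add]
      lia
    calc (a + r).descFactorial (j + 1) * p ^ (j + 1)
        = ((a + r - j) * p) * ((a + r).descFactorial j * p ^ j) := by
          rw [Nat.descFactorial_succ, pow_succ]; ring
      _ ≤ ((a - j) * (p + 1)) * (a.descFactorial j * (p + 1) ^ j) :=
          Nat.mul_le_mul hfactor (ih (by lia))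
      _ = a.descFactorial (j + 1) * (p + 1) ^ (j + 1) := by
          rw [Nat.descFactorial_succ, pow_succ]; ring

theorem choose_add_le_succ_mul_choose {a p r : ℕ} (hp : 0 < p) (h : r * p + p ≤ a + 1) :
    (a + r).choose p ≤ (p + 1) * a.choose p := by
  have hdesc : (a + r).descFactorial p ≤ (p + 1) * a.descFactorial p := by
    refine Nat.le_of_mul_le_mul_right ?_ (pow_pos hp p)
    calc (a + r).descFactorial p * p ^ p
        ≤ a.descFactorial p * (p + 1) ^ p := descFactorial_add_mul_pow_le h le_rfl
      _ ≤ a.descFactorial p * ((p + 1) * p ^ p) := by gcongr; exact succ_pow_self_le p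
      _ = (p + 1) * a.descFactorial p * p ^ p := by ring
  rw [Nat.descFactorial_eq_factorial_mul_choose, Nat.descFactorial_eq_factorial_mul_choose] at hdesc
  refine Nat.le_of_mul_le_mul_left ?_ p.factorial_pos
  linarith

theorem choose_succ_eq_mul_choose (p t : ℕ) :
    ((p + 1) * t + p).choose (p + 1) = t * ((p + 1) * t + p).choose p := by
  refine Nat.eq_of_mul_eq_mul_right p.succ_pos ?_
  rw [Nat.succ_eq_add_one, Nat.choose_succ_right_eq, Nat.add_sub_cancel]
  ring

/-- For `k ≥ 2`, `s ≥ 1` and `n ≥ ks`,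
`max{ C(ks+k−1,k), C(n,k) − C(n−s,k) } ≥
 max{ C(ks−1,k), C(n−1,k) − C(n−s,k) } + C(n−1,k−1)`. -/
theorem max_binomial_recursion (k s n : ℕ) (hk : 2 ≤ k) (hs : 1 ≤ s)
    (hn : k * s ≤ n) :
    max ((k * s - 1).choose k) ((n - 1).choose k - (n - s).choose k) +
        (n - 1).choose (k - 1) ≤
      max ((k * s + k - 1).choose k) (n.choose k - (n - s).choose k) := by
  obtain ⟨p, rfl⟩ : ∃ p, k = p + 1 := ⟨k - 1, by lia⟩
  obtain ⟨t, rfl⟩ : ∃ t, s = t + 1 := ⟨s - 1, by lia⟩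
  have hks : (p + 1) * (t + 1) = (p + 1) * t + p + 1 := by ring
  obtain ⟨q, rfl⟩ : ∃ q, n = q + 1 := ⟨n - 1, by lia⟩
  have hsub : q + 1 - (t + 1) = q - t := by lia
  have hpascal : (q + 1).choose (p + 1) = q.choose p + q.choose (p + 1) :=
    Nat.choose_succ_succ _ _
  have hmono : (q - t).choose (p + 1) ≤ q.choose (p + 1) :=
    Nat.choose_le_choose _ (Nat.sub_le q t)
  have htop : (p + 1) * (t + 1) + (p + 1) - 1 = (p + 1) * t + p + (p + 1) := by lia
  have hbot : (p + 1) * (t + 1) - 1 = (p + 1) * t + p := by lia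
  simp only [htop, hbot, hsub, Nat.add_sub_cancel]
  rw [← max_add_add_right]
  refine max_le ?_ (le_max_of_le_right (by lia))
  set a := (p + 1) * t + p with ha
  rcases le_or_gt (a + t) q with hq | hq
  · have h1 := choose_add_mul_choose_le (q - t) p t
    have h2 : t * a.choose p ≤ t * (q - t).choose p :=
      Nat.mul_le_mul_left t (Nat.choose_le_choose p (by lia))
    have h3 : a.choose (p + 1) = t * a.choose p := choose_succ_eq_mul_choose p t
    rw [Nat.sub_add_cancel (by lia)] at h1
    exact le_max_of_le_right (by lia)
  · have h1 := choose_add_mul_choose_le a p (p + 1)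
    obtain ⟨r, rfl⟩ := Nat.exists_eq_add_of_le (show a ≤ q by lia)
    have hr : r * p ≤ t * p := Nat.mul_le_mul_right p (by lia)
    have h2 : (a + r).choose p ≤ (p + 1) * a.choose p :=
      choose_add_le_succ_mul_choose (by lia) (by rw [ha, add_mul, mul_comm p t]; lia)
    exact le_max_of_le_left (by lia)
end

section
/- Let k ≥ 2, s ≥ 1 and n ≥ ks+k−1, and let 𝓕 be a stable family of k-element subsets of [n] with ν(𝓕) = s and ν(𝓕(1̄)) = s. Then every F ∈ 𝓕 satisfies |F ∩ [ks+k−1]| ≥ 2. -/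
theorem bddAbove_matching_cards (𝓕 : Finset (Finset ℕ)) :
    BddAbove {m | ∃ M ⊆ 𝓕, M.card = m ∧ (∀ A ∈ M, A.Nonempty) ∧
      (M : Set (Finset ℕ)).Pairwise fun A B => Disjoint A B} := by
  refine ⟨𝓕.card, ?_⟩
  rintro m ⟨M, hM, rfl, -⟩
  exact Finset.card_le_card hM

theorem exists_matching_card_eq_matchNum (𝓕 : Finset (Finset ℕ)) :
    ∃ M ⊆ 𝓕, M.card = matchNum 𝓕 ∧ (∀ A ∈ M, A.Nonempty) ∧
      (M : Set (Finset ℕ)).Pairwise fun A B => Disjoint A B :=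
  Nat.sSup_mem (s := {m | ∃ M ⊆ 𝓕, M.card = m ∧ (∀ A ∈ M, A.Nonempty) ∧
    (M : Set (Finset ℕ)).Pairwise fun A B => Disjoint A B})
    ⟨0, ∅, by simp⟩ (bddAbove_matching_cards 𝓕)

theorem card_le_matchNum {𝓕 M : Finset (Finset ℕ)} (hM : M ⊆ 𝓕)
    (hne : ∀ A ∈ M, A.Nonempty)
    (hd : (M : Set (Finset ℕ)).Pairwise fun A B => Disjoint A B) :
    M.card ≤ matchNum 𝓕 :=
  le_csSup (bddAbove_matching_cards 𝓕) ⟨M, hM, rfl, hne, hd⟩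

theorem Stable.image_mem {n : ℕ} {𝓕 : Finset (Finset ℕ)} (hst : Stable n 𝓕)
    {A : Finset ℕ} (hA : A ∈ 𝓕) (hAn : A ⊆ Finset.Icc 1 n) {φ : ℕ → ℕ}
    (hinj : Set.InjOn φ A) (hφ : ∀ x ∈ A, 1 ≤ φ x ∧ φ x ≤ x) :
    A.image φ ∈ 𝓕 := by
  refine hst A hA _ ?_ (Finset.card_image_of_injOn hinj) ⟨φ, ?_, fun x hx => (hφ x hx).2⟩
  · intro y hy
    obtain ⟨x, hx, rfl⟩ := Finset.mem_image.1 hy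
    have h := Finset.mem_Icc.1 (hAn hx)
    exact Finset.mem_Icc.2 ⟨(hφ x hx).1, (hφ x hx).2.trans h.2⟩
  · rw [Finset.coe_image]
    exact hinj.bijOn_image

theorem injOn_card_filter_le (U : Finset ℕ) :
    Set.InjOn (fun x => (U.filter (· ≤ x)).card) U := by
  refine StrictMonoOn.injOn fun x _ y hy hxy => Finset.card_lt_card ?_
  rw [Finset.ssubset_iff_of_subset]
  · exact ⟨y, by simpa using hy, by simp [hxy]⟩
  · intro z hz
    simp only [Finset.mem_filter] at hz ⊢
    exact ⟨hz.1, hz.2.trans hxy.le⟩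

theorem one_le_card_filter_le {U : Finset ℕ} {x : ℕ} (hx : x ∈ U) :
    1 ≤ (U.filter (· ≤ x)).card :=
  Finset.card_pos.2 ⟨x, by simp [hx]⟩

/-- A matching of `k`-sets avoiding `1` in a stable family can be compressed to a matching of the
same size inside `{2, …, k * s + 1}`. -/
theorem Stable.exists_compressed_matching {n k : ℕ} (hk : 1 ≤ k) {𝓕 M : Finset (Finset ℕ)}
    (h𝓕 : 𝓕 ⊆ Finset.powersetCard k (Finset.Icc 1 n)) (hst : Stable n 𝓕)
    (hM : M ⊆ 𝓕.filter fun F => 1 ∉ F)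
    (hd : (M : Set (Finset ℕ)).Pairwise fun A B => Disjoint A B) :
    ∃ N ⊆ 𝓕, N.card = M.card ∧ (∀ A ∈ N, A ⊆ Finset.Icc 2 (k * M.card + 1)) ∧
      (N : Set (Finset ℕ)).Pairwise fun A B => Disjoint A B := by
  set U := M.biUnion id with hU
  have hmem : ∀ A ∈ M, A ∈ 𝓕 ∧ 1 ∉ A ∧ A ⊆ Finset.Icc 1 n ∧ A.card = k := by
    intro A hA
    have h1 := Finset.mem_filter.1 (hM hA)
    have h2 := Finset.mem_powersetCard.1 (h𝓕 h1.1)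
    exact ⟨h1.1, h1.2, h2.1, h2.2⟩
  have hAU : ∀ A ∈ M, A ⊆ U := fun A hA => Finset.subset_biUnion_of_mem id hA
  have hUcard : U.card ≤ k * M.card := by
    rw [mul_comm]
    exact Finset.card_biUnion_le_card_mul _ _ _ fun A hA => (hmem A hA).2.2.2.le
  have hU2 : ∀ x ∈ U, 2 ≤ x := by
    intro x hx
    obtain ⟨A, hA, hxA⟩ := Finset.mem_biUnion.1 hx
    obtain ⟨-, h1, hAn, -⟩ := hmem A hA
    have := (Finset.mem_Icc.1 (hAn hxA)).1
    have : x ≠ 1 := fun h => h1 (h ▸ hxA)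
    omega
  let φ : ℕ → ℕ := fun x => 1 + (U.filter (· ≤ x)).card
  have hφinj : Set.InjOn φ U := fun x hx y hy h =>
    injOn_card_filter_le U hx hy (Nat.add_left_cancel h)
  have hφ1 : ∀ x ∈ U, 2 ≤ φ x := fun x hx =>
    Nat.add_le_add_left (one_le_card_filter_le hx) 1
  have hφle : ∀ x ∈ U, φ x ≤ x := by
    intro x hx
    have hsub : U.filter (· ≤ x) ⊆ Finset.Icc 2 x := fun y hy => by
      obtain ⟨hy1, hy2⟩ := Finset.mem_filter.1 hy
      exact Finset.mem_Icc.2 ⟨hU2 y hy1, hy2⟩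
    have h := Finset.card_le_card hsub
    have := hU2 x hx
    simp only [Nat.card_Icc] at h
    simp only [φ]
    omega
  have hφU : ∀ x, φ x ≤ k * M.card + 1 := fun x => by
    have := Finset.card_filter_le U (· ≤ x)
    simp only [φ]
    omega
  have hdisj : ∀ A ∈ M, ∀ B ∈ M, A ≠ B → Disjoint (A.image φ) (B.image φ) := by
    intro A hA B hB hAB
    rw [Finset.disjoint_left]
    intro y hyA hyB
    obtain ⟨a, ha, rfl⟩ := Finset.mem_image.1 hyA
    obtain ⟨b, hb, hba⟩ := Finset.mem_image.1 hyB
    have := hφinj (hAU B hB hb) (hAU A hA ha) hba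
    subst this
    exact Finset.disjoint_left.1 (hd hA hB hAB) ha hb
  refine ⟨M.image (Finset.image φ), ?_, ?_, ?_, ?_⟩
  · intro C hC
    obtain ⟨A, hA, rfl⟩ := Finset.mem_image.1 hC
    obtain ⟨hAF, -, hAn, -⟩ := hmem A hA
    exact hst.image_mem hAF hAn (hφinj.mono (by exact_mod_cast hAU A hA))
      fun x hx => ⟨by have := hφ1 x (hAU A hA hx); omega, hφle x (hAU A hA hx)⟩
  · refine Finset.card_image_of_injOn fun A hA B hB hAB => ?_
    by_contra hne
    have h := hdisj A hA B hB hne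
    rw [← hAB, disjoint_self, Finset.bot_eq_empty, Finset.image_eq_empty] at h
    have := (hmem A hA).2.2.2
    simp only [h, Finset.card_empty] at this
    omega
  · intro C hC y hy
    obtain ⟨A, hA, rfl⟩ := Finset.mem_image.1 hC
    obtain ⟨x, hx, rfl⟩ := Finset.mem_image.1 hy
    exact Finset.mem_Icc.2 ⟨hφ1 x (hAU A hA hx), hφU x⟩
  · intro C hC D hD hCD
    obtain ⟨A, hA, rfl⟩ := Finset.mem_image.1 hC
    obtain ⟨B, hB, rfl⟩ := Finset.mem_image.1 hD
    exact hdisj A hA B hB fun h => hCD (by rw [h])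

/-- A member of a stable `k`-uniform family with at most one element in `{1, …, t + k - 1}` can be
shifted to a member disjoint from `{2, …, t + 1}`. -/
theorem Stable.exists_mem_disjoint {n k t : ℕ} (hk : 1 ≤ k) {𝓕 : Finset (Finset ℕ)}
    (h𝓕 : 𝓕 ⊆ Finset.powersetCard k (Finset.Icc 1 n)) (hst : Stable n 𝓕)
    {F : Finset ℕ} (hF : F ∈ 𝓕) (hcard : (F ∩ Finset.Icc 1 (t + k - 1)).card ≤ 1) :
    ∃ G ∈ 𝓕, Disjoint G (Finset.Icc 2 (t + 1)) := by
  obtain ⟨hFn, hFk⟩ := Finset.mem_powersetCard.1 (h𝓕 hF)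
  have hsd : k - 1 ≤ (F \ Finset.Icc 1 (t + k - 1)).card := by
    have := Finset.card_sdiff_add_card_inter F (Finset.Icc 1 (t + k - 1))
    omega
  obtain ⟨H, hH, hHk⟩ := Finset.exists_subset_card_eq hsd
  have hHF : H ⊆ F := hH.trans Finset.sdiff_subset
  have hFH : (F \ H).card ≤ 1 := by
    rw [Finset.card_sdiff_of_subset hHF]
    omega
  have hHlarge : ∀ x ∈ H, t + k ≤ x := by
    intro x hx
    obtain ⟨h1, h2⟩ := Finset.mem_sdiff.1 (hH hx)
    have := (Finset.mem_Icc.1 (hFn h1)).1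
    rw [Finset.mem_Icc] at h2
    omega
  let ψ : ℕ → ℕ := fun x => if x ∈ H then t + 1 + (H.filter (· ≤ x)).card else 1
  have hψH : ∀ x ∈ H, ψ x = t + 1 + (H.filter (· ≤ x)).card := fun x hx => if_pos hx
  have hψn : ∀ x ∉ H, ψ x = 1 := fun x hx => if_neg hx
  refine ⟨F.image ψ, hst.image_mem hF hFn ?_ ?_, ?_⟩
  · intro x hx y hy hxy
    by_cases hxH : x ∈ H <;> by_cases hyH : y ∈ H
    · rw [hψH x hxH, hψH y hyH] at hxy
      exact injOn_card_filter_le H hxH hyH (Nat.add_left_cancel hxy)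
    · rw [hψH x hxH, hψn y hyH] at hxy
      have := one_le_card_filter_le hxH
      omega
    · rw [hψn x hxH, hψH y hyH] at hxy
      have := one_le_card_filter_le hyH
      omega
    · exact Finset.card_le_one.1 hFH x (Finset.mem_sdiff.2 ⟨hx, hxH⟩) y
        (Finset.mem_sdiff.2 ⟨hy, hyH⟩)
  · intro x hx
    by_cases hxH : x ∈ H
    · rw [hψH x hxH]
      have := hHlarge x hxH
      have := Finset.card_filter_le H (· ≤ x)
      omega
    · rw [hψn x hxH]
      exact ⟨le_rfl, (Finset.mem_Icc.1 (hFn hx)).1⟩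
  · rw [Finset.disjoint_left]
    intro y hy hyI
    obtain ⟨x, hx, rfl⟩ := Finset.mem_image.1 hy
    rw [Finset.mem_Icc] at hyI
    by_cases hxH : x ∈ H
    · rw [hψH x hxH] at hyI
      have := one_le_card_filter_le hxH
      omega
    · rw [hψn x hxH] at hyI
      omega

/-- If `𝓕` is a stable family of `k`-subsets of `[n]` with
`ν(𝓕) = ν(𝓕(1̄)) = s`, then every member meets `[ks+k−1]` in at least two
elements. -/
theorem trace_card_ge_two (k s n : ℕ) (hk : 2 ≤ k) (hs : 1 ≤ s)
    (hn : k * s + k - 1 ≤ n)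
    (𝓕 : Finset (Finset ℕ)) (h𝓕 : 𝓕 ⊆ Finset.powersetCard k (Finset.Icc 1 n))
    (hst : Stable n 𝓕) (hν : matchNum 𝓕 = s)
    (hν1 : matchNum (𝓕.filter fun F => 1 ∉ F) = s) :
    ∀ F ∈ 𝓕, 2 ≤ (F ∩ Finset.Icc 1 (k * s + k - 1)).card := by
  intro F hF
  by_contra hlt
  obtain ⟨M, hM, hMcard, -, hMd⟩ := exists_matching_card_eq_matchNum (𝓕.filter fun F => 1 ∉ F)
  obtain ⟨N, hN, hNcard, hNI, hNd⟩ :=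
    hst.exists_compressed_matching (by omega) h𝓕 hM hMd
  rw [hMcard, hν1] at hNcard hNI
  obtain ⟨G, hG, hGd⟩ := hst.exists_mem_disjoint (t := k * s) (by omega) h𝓕 hF (by omega)
  have hne : ∀ A ∈ 𝓕, A.Nonempty := fun A hA => by
    rw [← Finset.card_pos, (Finset.mem_powersetCard.1 (h𝓕 hA)).2]
    omega
  have hGA : ∀ A ∈ N, Disjoint G A := fun A hA => hGd.mono_right (hNI A hA)
  have hGN : G ∉ N := fun h => (hne G hG).ne_empty (disjoint_self.1 (hGA G h))
  have hsub : insert G N ⊆ 𝓕 := Finset.insert_subset hG hN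
  have hle := card_le_matchNum hsub (fun A hA => hne A (hsub hA)) (by
    rw [Finset.coe_insert]
    exact hNd.insert fun A hA _ => ⟨hGA A hA, (hGA A hA).symm⟩)
  rw [Finset.card_insert_of_notMem hGN] at hle
  omega
end

section
/- For all integers k ≥ 2 and s ≥ 1, setting m = ks + ⌊s/2⌋ + k (the integer part of (k + 1/2)s + k), one has C(m,k) − C(m−s,k) ≥ C(k(s+1)−1, k). Consequently the pivotal number n₀(s,k), defined as the least n with C(ks+k−1,k) ≤ C(n,k) − C(n−s,k), satisfies n₀(s,k) ≤ (k + 1/2)s + k. -/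
/-- Evaluating a polynomial with natural coefficients at integers `-b ≤ 0 < a` with `b < a`:
the increment from `-b` to `a` is at least `a + b` times the increment from `0` to `1`. -/
lemma Polynomial.add_mul_eval_one_sub_le_aeval_sub (p : Polynomial ℕ) {a b : ℕ} (hab : b < a) :
    ((a : ℤ) + b) * (Polynomial.aeval (1 : ℤ) p - Polynomial.aeval (0 : ℤ) p) ≤
      Polynomial.aeval (a : ℤ) p - Polynomial.aeval (-(b : ℤ)) p := by
  induction p using Polynomial.induction_on' with
  | add p q hp hq =>
    simp only [map_add]
    linarith
  | monomial n c =>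
    have hpow : 0 < n → (a : ℤ) + b ≤ (a : ℤ) ^ n - (-(b : ℤ)) ^ n := by
      intro hn
      have ha : 1 ≤ a := by omega
      rcases Nat.even_or_odd n with he | ho
      · obtain ⟨m, rfl⟩ : ∃ m, n = m + 2 := ⟨n - 2, by obtain ⟨r, hr⟩ := he; omega⟩
        rw [he.neg_pow]
        have hm : (b : ℤ) ^ m ≤ (a : ℤ) ^ m := by
          gcongr
        have hm1 : (1 : ℤ) ≤ (a : ℤ) ^ m := by
          exact_mod_cast Nat.one_le_pow m a ha
        have hsq : (a : ℤ) + b ≤ (a : ℤ) ^ 2 - (b : ℤ) ^ 2 := by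
          have : (b : ℤ) + 1 ≤ a := by exact_mod_cast hab
          nlinarith
        rw [pow_add, pow_add]
        nlinarith [mul_le_mul_of_nonneg_right hm (sq_nonneg (b : ℤ)),
          mul_le_mul_of_nonneg_right hm1 (show (0 : ℤ) ≤ (a : ℤ) ^ 2 - (b : ℤ) ^ 2 by omega)]
      · rw [ho.neg_pow]
        have h1 : (a : ℤ) ≤ (a : ℤ) ^ n := by exact_mod_cast Nat.le_self_pow hn.ne' a
        have h2 : (b : ℤ) ≤ (b : ℤ) ^ n := by exact_mod_cast Nat.le_self_pow hn.ne' b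
        linarith
    rcases Nat.eq_zero_or_pos n with rfl | hn
    · simp
    · simp only [Polynomial.aeval_monomial, one_pow, zero_pow hn.ne', mul_one, mul_zero, sub_zero,
        eq_natCast]
      rw [← mul_sub, mul_comm]
      exact mul_le_mul_of_nonneg_left (hpow hn) (by positivity)

/-- If `b < a` and `b ≤ n`, the increment of the rising factorial from `n - b` to `n + a` is at
least `a + b` times its increment from `n` to `n + 1`. -/
lemma Nat.add_mul_ascFactorial_succ_sub_le {n a b : ℕ} (k : ℕ) (hab : b < a) (hb : b ≤ n) :
    ((a : ℤ) + b) * ((n + 1).ascFactorial k - n.ascFactorial k) ≤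
      (n + a).ascFactorial k - (n - b).ascFactorial k := by
  have haeval (y : ℤ) (x : ℕ) (hx : (x : ℤ) = y + n) :
      Polynomial.aeval y ((ascPochhammer ℕ k).comp (Polynomial.X + Polynomial.C n)) =
        (x.ascFactorial k : ℤ) := by
    rw [Polynomial.aeval_comp, map_add, Polynomial.aeval_X, Polynomial.aeval_C, eq_natCast, ← hx,
      ← ascPochhammer_nat_eq_ascFactorial, ← Polynomial.eval_map_algebraMap]
    simp
  have h := Polynomial.add_mul_eval_one_sub_le_aeval_sub
    ((ascPochhammer ℕ k).comp (Polynomial.X + Polynomial.C n)) hab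
  rwa [haeval 1 (n + 1) (by push_cast; ring), haeval 0 n (by simp),
    haeval a (n + a) (by push_cast; ring), haeval (-b) (n - b) (by omega)] at h

/-- A lower bound for a difference of binomial coefficients whose upper arguments differ by
`s = a + b`. -/
lemma Nat.choose_add_choose_le_choose {k s a b : ℕ} (hk : 1 ≤ k) (hs : 1 ≤ s) (hab : b < a)
    (hsum : a + b = s) :
    (k * s + k - 1).choose k + (k * s - b + k - 1).choose k ≤ (k * s + a + k - 1).choose k := by
  have hb : b ≤ k * s := by nlinarith
  have h := Nat.add_mul_ascFactorial_succ_sub_le k hab hb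
  have hstep : (s : ℤ) * ((k * s + 1).ascFactorial k - (k * s).ascFactorial k) =
      (k * s).ascFactorial k := by
    have h1 : k * s * (k * s + 1).ascFactorial k = (k * s + k) * (k * s).ascFactorial k :=
      Nat.succ_ascFactorial (k * s) k
    have h2 : (k : ℤ) * (s * (k * s + 1).ascFactorial k) =
        k * ((s + 1) * (k * s).ascFactorial k) := by
      have h3 : ((k * s * (k * s + 1).ascFactorial k : ℕ) : ℤ) =
          (((k * s + k) * (k * s).ascFactorial k : ℕ) : ℤ) := congrArg _ h1
      push_cast at h3
      linear_combination h3
    have h4 := mul_left_cancel₀ (by positivity) h2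
    linear_combination h4
  have hcast : (a : ℤ) + b = s := by exact_mod_cast hsum
  rw [hcast, hstep] at h
  have h' : (k * s).ascFactorial k + (k * s - b).ascFactorial k ≤
      (k * s + a).ascFactorial k := by
    zify
    linarith
  simp only [Nat.ascFactorial_eq_factorial_mul_choose'] at h'
  rw [← mul_add] at h'
  exact Nat.le_of_mul_le_mul_left h' k.factorial_pos

/-- With `m = ks + ⌊s/2⌋ + k` one has `C(m,k) − C(m−s,k) ≥ C(k(s+1)−1,k)`;
consequently the pivotal number `n₀(s,k)`, the least `n` with
`C(ks+k−1,k) ≤ C(n,k) − C(n−s,k)`, satisfies `n₀(s,k) ≤ (k + 1/2)s + k`. -/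
theorem pivotal_number_bound (k s : ℕ) (hk : 2 ≤ k) (hs : 1 ≤ s) :
    (k * (s + 1) - 1).choose k ≤
        (k * s + s / 2 + k).choose k - (k * s + s / 2 + k - s).choose k ∧
      2 * sInf {n : ℕ |
          (k * s + k - 1).choose k ≤ n.choose k - (n - s).choose k} ≤
        (2 * k + 1) * s + 2 * k := by
  have hks : s ≤ k * s := by nlinarith
  have hle := Nat.choose_add_choose_le_choose (k := k) (a := s / 2 + 1) (b := s - s / 2 - 1)
    (by omega) hs (by omega) (by omega)
  rw [show k * s - (s - s / 2 - 1) + k - 1 = k * s + s / 2 + k - s by omega,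
    show k * s + (s / 2 + 1) + k - 1 = k * s + s / 2 + k by omega] at hle
  have hmain := Nat.le_sub_of_add_le hle
  refine ⟨by rwa [Nat.mul_succ], ?_⟩
  have hinf : sInf {n : ℕ | (k * s + k - 1).choose k ≤ n.choose k - (n - s).choose k} ≤
      k * s + s / 2 + k := Nat.sInf_le hmain
  have hhalf : 2 * (s / 2) ≤ s := Nat.mul_div_le s 2
  linarith
end

section
/- Let k ≥ 1, s ≥ 1 and n ≥ ks+k−1, and let 𝓕 be a stable family of k-element subsets of [n] with ν(𝓕) = s. Suppose F₁,…,F_s ∈ 𝓕 are pairwise disjoint with F₁ ∪ ⋯ ∪ F_s ⊆ [ks+k−1], and let D = [ks+k−1] \ (F₁ ∪ ⋯ ∪ F_s). For R ⊆ [s] let X(R) = D ∪ ⋃_{r∈R} F_r and 𝓗(R) = { H ∈ 𝓕₀ : H ⊆ X(R) }, where 𝓕₀ = { F ∩ [ks+k−1] : F ∈ 𝓕 } is the trace family. Then the maximum number of pairwise disjoint nonempty members of 𝓗(R) equals |R|. -/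
/-- An indexed family of pairwise disjoint nonempty members of `𝓕` bounds `matchNum 𝓕` from
below. -/
theorem card_index_le_matchNum {ι : Type*} {𝓕 : Finset (Finset ℕ)} (I : Finset ι)
    (P : ι → Finset ℕ) (hP : ∀ i ∈ I, P i ∈ 𝓕) (hne : ∀ i ∈ I, (P i).Nonempty)
    (hd : ∀ i ∈ I, ∀ j ∈ I, i ≠ j → Disjoint (P i) (P j)) : I.card ≤ matchNum 𝓕 := by
  have hinj : Set.InjOn P I := by
    intro i hi j hj hij
    by_contra hne'
    have h := hd i hi j hj hne'
    rw [← hij, disjoint_self] at h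
    exact (hne i hi).ne_empty h
  rw [← Finset.card_image_of_injOn hinj]
  apply card_le_matchNum
  · exact Finset.image_subset_iff.2 hP
  · exact Finset.forall_mem_image.2 hne
  · intro A hA B hB hAB
    obtain ⟨i, hi, rfl⟩ := Finset.mem_image.1 (Finset.mem_coe.1 hA)
    obtain ⟨j, hj, rfl⟩ := Finset.mem_image.1 (Finset.mem_coe.1 hB)
    exact hd i hi j hj fun h => hAB (h ▸ rfl)

/-- In a stable family an element may be replaced by a smaller new one. -/
theorem Stable.insert_erase_mem {n : ℕ} {𝓕 : Finset (Finset ℕ)} (hst : Stable n 𝓕)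
    {A : Finset ℕ} (hA : A ∈ 𝓕) (hAn : A ⊆ Finset.Icc 1 n) {x y : ℕ} (hx : x ∈ A) (hy : y ∉ A)
    (hy1 : 1 ≤ y) (hyx : y ≤ x) : insert y (A.erase x) ∈ 𝓕 := by
  have hxn := Finset.mem_Icc.1 (hAn hx)
  refine hst A hA _ ?_ ?_ ⟨fun z => if z = x then y else z, ⟨?_, ?_, ?_⟩, ?_⟩
  · refine Finset.insert_subset (Finset.mem_Icc.2 ⟨hy1, hyx.trans hxn.2⟩) ?_
    exact (Finset.erase_subset _ _).trans hAn
  · rw [Finset.card_insert_of_notMem fun h => hy (Finset.mem_of_mem_erase h),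
      Finset.card_erase_add_one hx]
  · intro z hz
    by_cases h : z = x <;> simp_all
  · intro z hz w hw h
    simp only at h
    split_ifs at h <;> simp_all
  · intro z hz
    simp only [Finset.coe_insert, Finset.coe_erase, Set.mem_insert_iff, Set.mem_sdiff,
      Finset.mem_coe, Set.mem_singleton_iff] at hz
    rcases hz with rfl | ⟨hz, hzx⟩
    · exact ⟨x, hx, by simp⟩
    · exact ⟨z, hz, by simp [hzx]⟩
  · intro z _
    dsimp only
    split_ifs with h
    · exact h ▸ hyx
    · exact le_rfl

/-- Members of a stable `k`-uniform family whose traces on `[N]` are pairwise disjoint can be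
shifted to pairwise disjoint members, provided there are at most `(N + 1) / k` of them. -/
theorem Stable.card_le_matchNum_of_disjoint_traces {ι : Type*} [Fintype ι] {k n N : ℕ}
    (hk : 1 ≤ k) {𝓕 : Finset (Finset ℕ)} (h𝓕 : 𝓕 ⊆ Finset.powersetCard k (Finset.Icc 1 n))
    (hst : Stable n 𝓕) (hN : k * Fintype.card ι ≤ N + 1) (P : ι → Finset ℕ)
    (hP : ∀ i, P i ∈ 𝓕)
    (hd : ∀ i j, i ≠ j → Disjoint (P i ∩ Finset.Icc 1 N) (P j ∩ Finset.Icc 1 N)) :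
    Fintype.card ι ≤ matchNum 𝓕 := by
  classical
  induction ht : ∑ i, (P i \ Finset.Icc 1 N).card using Nat.strong_induction_on generalizing P with
  | _ t ih =>
  have hPn (i) : P i ⊆ Finset.Icc 1 n := (Finset.mem_powersetCard.1 (h𝓕 (hP i))).1
  have hPk (i) : (P i).card = k := (Finset.mem_powersetCard.1 (h𝓕 (hP i))).2
  by_cases hdis : ∀ i j, i ≠ j → Disjoint (P i) (P j)
  · exact card_index_le_matchNum Finset.univ P (fun i _ => hP i)
      (fun i _ => Finset.card_pos.1 (by rw [hPk]; exact hk)) fun i _ j _ => hdis i j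
  push Not at hdis
  obtain ⟨i, j, hij, hnd⟩ := hdis
  obtain ⟨x, hxi, hxj⟩ := Finset.not_disjoint_iff.1 hnd
  have hxN : x ∉ Finset.Icc 1 N := fun h =>
    Finset.disjoint_left.1 (hd i j hij) (Finset.mem_inter.2 ⟨hxi, h⟩) (Finset.mem_inter.2 ⟨hxj, h⟩)
  have htwo : 2 ≤ ∑ i, (P i \ Finset.Icc 1 N).card := by
    have hi : 0 < (P i \ Finset.Icc 1 N).card :=
      Finset.card_pos.2 ⟨x, Finset.mem_sdiff.2 ⟨hxi, hxN⟩⟩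
    have hj : 0 < (P j \ Finset.Icc 1 N).card :=
      Finset.card_pos.2 ⟨x, Finset.mem_sdiff.2 ⟨hxj, hxN⟩⟩
    have hle := Finset.sum_le_sum_of_subset (f := fun i => (P i \ Finset.Icc 1 N).card)
      (Finset.subset_univ {i, j})
    rw [Finset.sum_pair hij] at hle
    omega
  have hsum : ∑ i, (P i ∩ Finset.Icc 1 N).card + ∑ i, (P i \ Finset.Icc 1 N).card =
      k * Fintype.card ι := by
    rw [← Finset.sum_add_distrib]
    simp [Finset.card_inter_add_card_sdiff, hPk, mul_comm]
  obtain ⟨y, hyN, hy⟩ : ∃ y ∈ Finset.Icc 1 N,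
      y ∉ Finset.univ.biUnion fun i => P i ∩ Finset.Icc 1 N := by
    apply Finset.exists_mem_notMem_of_card_lt_card
    refine Finset.card_biUnion_le.trans_lt ?_
    rw [Nat.card_Icc]
    omega
  have hyP (l) : y ∉ P l := fun h =>
    hy (Finset.mem_biUnion.2 ⟨l, Finset.mem_univ _, Finset.mem_inter.2 ⟨h, hyN⟩⟩)
  have hx1 := (Finset.mem_Icc.1 (hPn i hxi)).1
  have hyb := Finset.mem_Icc.1 hyN
  have hyx : y ≤ x := by
    rw [Finset.mem_Icc] at hxN
    omega
  have hmem := hst.insert_erase_mem (hP i) (hPn i) hxi (hyP i) hyb.1 hyx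
  have htrace (l) (hl : l ≠ i) :
      Disjoint (insert y ((P i).erase x) ∩ Finset.Icc 1 N) (P l ∩ Finset.Icc 1 N) := by
    have h := hd i l hl.symm
    rw [Finset.disjoint_left] at h ⊢
    intro z hz hzl
    rw [Finset.mem_inter, Finset.mem_insert] at hz
    rcases hz.1 with rfl | hz'
    · exact hyP l (Finset.mem_inter.1 hzl).1
    · exact h (Finset.mem_inter.2 ⟨Finset.mem_of_mem_erase hz', hz.2⟩) hzl
  refine ih _ ?_ (Function.update P i (insert y ((P i).erase x))) ?_ ?_ rfl
  · rw [← ht]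
    refine Finset.sum_lt_sum (fun l _ => ?_) ⟨i, Finset.mem_univ _, ?_⟩
    · rcases eq_or_ne l i with rfl | hl
      · rw [Function.update_self]
        apply Finset.card_le_card
        rw [Finset.insert_sdiff_of_mem _ hyN]
        exact Finset.sdiff_subset_sdiff (Finset.erase_subset _ _) le_rfl
      · rw [Function.update_of_ne hl]
    · rw [Function.update_self, Finset.insert_sdiff_of_mem _ hyN]
      apply Finset.card_lt_card
      rw [Finset.ssubset_iff_of_subset (Finset.sdiff_subset_sdiff (Finset.erase_subset _ _) le_rfl)]
      exact ⟨x, Finset.mem_sdiff.2 ⟨hxi, hxN⟩, by simp⟩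
  · intro l
    rcases eq_or_ne l i with rfl | hl
    · rwa [Function.update_self]
    · rw [Function.update_of_ne hl]
      exact hP l
  · intro a b hab
    rcases eq_or_ne a i with rfl | ha
    · rw [Function.update_self, Function.update_of_ne hab.symm]
      exact htrace b hab.symm
    rw [Function.update_of_ne ha]
    rcases eq_or_ne b i with rfl | hb
    · rw [Function.update_self]
      exact (htrace a ha).symm
    · rw [Function.update_of_ne hb]
      exact hd a b hab

/-- With `F₁,…,F_s ∈ 𝓕` pairwise disjoint inside `[ks+k−1]` and
`D = [ks+k−1] \ (F₁ ∪ ⋯ ∪ F_s)`, the restriction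
`𝓗(R) = { H ∈ 𝓕₀ : H ⊆ D ∪ ⋃_{r∈R} F_r }` of the trace family has matching
number (maximum number of pairwise disjoint nonempty members) equal to `|R|`. -/
theorem restriction_matching_number (k s n : ℕ) (hk : 1 ≤ k) (hs : 1 ≤ s)
    (hn : k * s + k - 1 ≤ n)
    (𝓕 : Finset (Finset ℕ)) (h𝓕 : 𝓕 ⊆ Finset.powersetCard k (Finset.Icc 1 n))
    (hst : Stable n 𝓕) (hν : matchNum 𝓕 = s)
    (F : Fin s → Finset ℕ) (hF : ∀ i, F i ∈ 𝓕)
    (hdisj : ∀ i j, i ≠ j → Disjoint (F i) (F j))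
    (hsub : Finset.univ.biUnion F ⊆ Finset.Icc 1 (k * s + k - 1))
    (R : Finset (Fin s)) :
    matchNum ((𝓕.image fun F' => F' ∩ Finset.Icc 1 (k * s + k - 1)).filter
      fun H => H ⊆ (Finset.Icc 1 (k * s + k - 1) \ Finset.univ.biUnion F) ∪
        R.biUnion F) = R.card := by
  classical
  have hFN (i) : F i ⊆ Finset.Icc 1 (k * s + k - 1) :=
    (Finset.subset_biUnion_of_mem F (Finset.mem_univ i)).trans hsub
  apply le_antisymm
  · refine csSup_le ⟨0, ∅, by simp⟩ ?_
    rintro m ⟨M, hM, rfl, -, hMd⟩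
    by_contra! hlt
    obtain ⟨L, hLM, hL⟩ := Finset.exists_subset_card_eq (Nat.succ_le_of_lt hlt)
    have hex (A : L) : ∃ B ∈ 𝓕, B ∩ Finset.Icc 1 (k * s + k - 1) = A.1 :=
      Finset.mem_image.1 (Finset.mem_filter.1 (hM (hLM A.2))).1
    choose B hB hBA using hex
    have hsubX (A : L) := (Finset.mem_filter.1 (hM (hLM A.2))).2
    have hcross (A : L) (r : (Rᶜ : Finset (Fin s))) : Disjoint A.1 (F r) := by
      rw [Finset.disjoint_left]
      intro z hz hzr
      rcases Finset.mem_union.1 (hsubX A hz) with h | h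
      · exact (Finset.mem_sdiff.1 h).2 (Finset.mem_biUnion.2 ⟨r, Finset.mem_univ _, hzr⟩)
      · obtain ⟨q, hq, hzq⟩ := Finset.mem_biUnion.1 h
        have hqr : q ≠ r := fun h => Finset.mem_compl.1 r.2 (h ▸ hq)
        exact Finset.disjoint_left.1 (hdisj q r hqr) hzq hzr
    have hcard : Fintype.card (L ⊕ (Rᶜ : Finset (Fin s))) = s + 1 := by
      have hR := Finset.card_add_card_compl R
      rw [Fintype.card_fin] at hR
      rw [Fintype.card_sum, Fintype.card_coe, Fintype.card_coe]
      omega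
    have key := hst.card_le_matchNum_of_disjoint_traces (N := k * s + k - 1) hk h𝓕
      (by rw [hcard, mul_add, mul_one]; omega)
      (Sum.elim B fun r : (Rᶜ : Finset (Fin s)) => F r)
      (by rintro (A | r); exacts [hB A, hF r])
      (by
        rintro (A | r) (A' | r') hne
        · simp only [Sum.elim_inl, hBA]
          exact hMd (hLM A.2) (hLM A'.2) fun h => hne (congrArg _ (Subtype.ext h))
        · simp only [Sum.elim_inl, Sum.elim_inr, hBA]
          exact (hcross A r').mono_right Finset.inter_subset_left
        · simp only [Sum.elim_inl, Sum.elim_inr, hBA]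
          exact (hcross A' r).symm.mono_left Finset.inter_subset_left
        · exact (hdisj r r' fun h => hne (congrArg _ (Subtype.ext h))).mono
            Finset.inter_subset_left Finset.inter_subset_left)
    omega
  · refine card_index_le_matchNum R F (fun i hi => ?_) (fun i _ => ?_) fun i _ j _ => hdisj i j
    · refine Finset.mem_filter.2 ⟨Finset.mem_image.2 ⟨F i, hF i, ?_⟩, ?_⟩
      · exact Finset.inter_eq_left.2 (hFN i)
      · exact (Finset.subset_biUnion_of_mem F hi).trans Finset.subset_union_right
    · rw [← Finset.card_pos, (Finset.mem_powersetCard.1 (h𝓕 (hF i))).2]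
      exact hk
end
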